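/- Let d ≥ 1, n > d, and let T, T' ∈ L(n,d) have the same type, γ_d(T) = γ_d(T'). Then κ_{n,d}(m, T) = κ_{n,d}(m, T') for every integer m ≥ 1. -/

import Mathlib

attribute [local instance] Classical.propDecidable

/-- Collections of subsets of `{1,…,n}` (modelled as `Fin n`). -/
abbrev Coll (n : ℕ) := Finset (Finset (Fin n))

/-- `codim_d X = d + 1 - |X|`. -/
def codim {n : ℕ} (d : ℕ) (X : Finset (Fin n)) : ℤ := (d : ℤ) + 1 - X.card

/-- `ρ_d T = Σ_{X ∈ T} codim_d X`. -/
def rho {n : ℕ} (d : ℕ) (T : Coll n) : ℤ := ∑ X ∈ T, codim d X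

/-- `D_d T = codim_d (T_1 ∩ … ∩ T_l) - ρ_d T` (used when `|T| ≥ 2`). -/
def Dd {n : ℕ} (d : ℕ) (T : Coll n) : ℤ := codim d (T.inf id) - rho d T

/-- Membership in the lattice `L(n,d)`. -/
def memL (n d : ℕ) (T : Coll n) : Prop :=
  (∀ T' ⊆ T, 2 ≤ T'.card → 0 < Dd d T') ∧ ∀ X ∈ T, X.card ≤ d

/-- The intersection lattice `L(n,d)`. -/
structure L (n d : ℕ) where
  val : Coll n
  mem : memL n d val

namespace L

instance (n d : ℕ) : PartialOrder (L n d) where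
  le S T := S = T ∨ (rho d S.val < rho d T.val ∧ ∀ X ∈ S.val, ∃ Y ∈ T.val, Y ⊆ X)
  le_refl S := Or.inl rfl
  le_trans S T U hST hTU := by
    rcases hST with rfl | hST
    · exact hTU
    · rcases hTU with rfl | hTU
      · exact Or.inr hST
      · refine Or.inr ⟨hST.1.trans hTU.1, fun X hX => ?_⟩
        obtain ⟨Y, hY, hYX⟩ := hST.2 X hX
        obtain ⟨Z, hZ, hZY⟩ := hTU.2 Y hY
        exact ⟨Z, hZ, hZY.trans hYX⟩
  le_antisymm S T hST hTS := by
    rcases hST with rfl | hST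
    · rfl
    · rcases hTS with rfl | hTS
      · rfl
      · exact absurd (hST.1.trans hTS.1) (lt_irrefl _)

noncomputable instance (n d : ℕ) : Fintype (L n d) :=
  Fintype.ofInjective (fun T : L n d => T.val)
    (fun a b h => by cases a; cases b; simpa using h)

end L

/-- The minimum element `∅` of `L(n,d)`. -/
def Lbot (n d : ℕ) : L n d :=
  ⟨∅, by
    constructor
    · intro T' hT' h2
      rw [Finset.subset_empty] at hT'
      subst hT'
      simp at h2
    · intro X hX
      simp at hX⟩

/-- The maximum element `{∅}` of `L(n,d)`. -/
def Ltop (n d : ℕ) : L n d :=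
  ⟨{∅}, by
    constructor
    · intro T' hT' h2
      have h1 : T'.card ≤ 1 := (Finset.card_le_card hT').trans_eq (Finset.card_singleton _)
      exact absurd h2 (by omega)
    · intro X hX
      rw [Finset.mem_singleton] at hX
      subst hX
      simp⟩

/-- The singleton collection `{X}` as an element of `L(n,d)`. -/
def singL (n d : ℕ) (X : Finset (Fin n)) (hX : X.card ≤ d) : L n d :=
  ⟨{X}, by
    constructor
    · intro T' hT' h2
      have h1 : T'.card ≤ 1 := (Finset.card_le_card hT').trans_eq (Finset.card_singleton _)
      exact absurd h2 (by omega)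
    · intro Y hY
      rw [Finset.mem_singleton] at hY
      subst hY
      exact hX⟩

/-- The type of `T ∈ L(n,d)`: the multiset of codimensions of its members. -/
def typeOf {n : ℕ} (d : ℕ) (T : L n d) : Multiset ℕ :=
  T.val.val.map (fun X => d + 1 - X.card)

/-- `λ_{n,d}(γ)`: the number of elements of `L(n,d)` of type `γ`. -/
noncomputable def lam (n d : ℕ) (γ : Multiset ℕ) : ℕ :=
  (Finset.univ.filter (fun T : L n d => typeOf d T = γ)).card

/-- `κ_{n,d}(m,T)`: the number of `m`-element sets of `d`-element subsets of `{1,…,n}`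
whose corresponding hyperplanes have least upper bound `T` in `L(n,d)`. -/
noncomputable def kappa (n d m : ℕ) (T : L n d) : ℕ :=
  (Finset.univ.filter (fun H : Coll n =>
      H.card = m ∧ (∀ X ∈ H, X.card = d) ∧
      IsLUB {S : L n d | ∃ X ∈ H, S.val = {X}} T)).card

/-- Every member of `S` contains some member of `T`. -/
def Refines {n : ℕ} (S T : Coll n) : Prop := ∀ X ∈ S, ∃ Y ∈ T, Y ⊆ X

/-- Every upper bound of the hyperplanes in `H` lies above `{A}`. -/
def Spans {n : ℕ} (d : ℕ) (H : Coll n) (A : Finset (Fin n)) : Prop :=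
  ∀ S, memL n d S → Refines H S → ∃ Z ∈ S, Z ⊆ A

section

variable {n d : ℕ}

theorem memL.mono {S T : Coll n} (hT : memL n d T) (h : S ⊆ T) : memL n d S :=
  ⟨fun T' hT' => hT.1 T' (hT'.trans h), fun X hX => hT.2 X (h hX)⟩

theorem memL.card_union {T : Coll n} (hT : memL n d T) {A B : Finset (Fin n)}
    (hA : A ∈ T) (hB : B ∈ T) (hAB : A ≠ B) : d + 1 < (A ∪ B).card := by
  have h := hT.1 {A, B} (by simp [Finset.insert_subset_iff, hA, hB])
    (Finset.card_pair hAB).ge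
  have h2 := Finset.card_union_add_card_inter A B
  simp only [Dd, rho, codim, Finset.inf_insert, Finset.inf_singleton, id,
    Finset.sum_pair hAB, Finset.inf_eq_inter] at h
  omega

theorem memL.eq_of_subset {T : Coll n} (hT : memL n d T) {A B X : Finset (Fin n)}
    (hA : A ∈ T) (hB : B ∈ T) (hX : X.card ≤ d) (hAX : A ⊆ X) (hBX : B ⊆ X) : A = B := by
  by_contra h
  have h1 := hT.card_union hA hB h
  have h2 := Finset.card_le_card (Finset.union_subset hAX hBX)
  omega

theorem codim_anti {X Y : Finset (Fin n)} (h : Y ⊆ X) : codim d X ≤ codim d Y := by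
  have := Finset.card_le_card h
  simp only [codim]
  omega

theorem memL.rho_le_codim {F : Coll n} (hF : memL n d F) {Y : Finset (Fin n)}
    (hY : Y.card ≤ d) (hYF : ∀ X ∈ F, Y ⊆ X) :
    rho d F ≤ codim d Y ∧ (rho d F = codim d Y → F = {Y}) := by
  rcases Nat.lt_or_ge F.card 2 with h | h
  · rcases Nat.lt_or_ge F.card 1 with h0 | h1
    · have : F = ∅ := Finset.card_eq_zero.1 (by omega)
      subst this
      simp only [rho, codim, Finset.sum_empty]
      constructor
      · omega
      · intro h
        omega
    · obtain ⟨X, rfl⟩ := Finset.card_eq_one.1 (show F.card = 1 by omega)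
      have hX := hYF X (by simp)
      simp only [rho, Finset.sum_singleton]
      refine ⟨codim_anti hX, fun h => ?_⟩
      rw [Finset.eq_of_subset_of_card_le hX]
      simp only [codim] at h
      omega
  · have h1 := hF.1 F subset_rfl h
    have h2 : codim d (F.inf id) ≤ codim d Y := codim_anti (Finset.le_inf hYF)
    simp only [Dd] at h1
    constructor
    · omega
    · intro h
      omega

theorem rho_le_of_refines {S T : Coll n} (hS : memL n d S) (hT : memL n d T)
    (h : Refines S T) : rho d S ≤ rho d T ∧ (rho d S = rho d T → S = T) := by
  choose! g hgT hg using h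
  have key : ∀ Y ∈ T, rho d (S.filter (fun X => g X = Y)) ≤ codim d Y ∧
      (rho d (S.filter (fun X => g X = Y)) = codim d Y → S.filter (fun X => g X = Y) = {Y}) := by
    intro Y hY
    refine (hS.mono (Finset.filter_subset _ _)).rho_le_codim (hT.2 Y hY) ?_
    intro X hX
    rw [Finset.mem_filter] at hX
    exact hX.2 ▸ hg X hX.1
  have hsum : rho d S = ∑ Y ∈ T, rho d (S.filter (fun X => g X = Y)) :=
    (Finset.sum_fiberwise_of_maps_to hgT _).symm
  rw [hsum]
  refine ⟨Finset.sum_le_sum fun Y hY => (key Y hY).1, fun heq => ?_⟩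
  have hfib := fun Y hY =>
    (key Y hY).2 ((Finset.sum_eq_sum_iff_of_le fun Y hY => (key Y hY).1).1 heq Y hY)
  ext X
  constructor
  · intro hX
    have hmem : X ∈ S.filter (fun X' => g X' = g X) := by simp [hX]
    rw [hfib _ (hgT X hX), Finset.mem_singleton] at hmem
    exact hmem ▸ hgT X hX
  · intro hX
    have hmem : X ∈ S.filter (fun X' => g X' = X) := by simp [hfib X hX]
    exact (Finset.mem_filter.1 hmem).1

theorem L.le_iff_refines {S T : L n d} : S ≤ T ↔ Refines S.val T.val := by
  constructor
  · rintro (rfl | h)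
    · exact fun X hX => ⟨X, hX, subset_rfl⟩
    · exact h.2
  · intro h
    obtain ⟨h1, h2⟩ := rho_le_of_refines S.mem T.mem h
    rcases h1.lt_or_eq with h1 | h1
    · exact Or.inr ⟨h1, h⟩
    · left
      cases S
      cases T
      simpa using h2 h1

theorem mem_upperBounds_iff_refines {H : Coll n} (hH : ∀ X ∈ H, X.card = d) {T : L n d} :
    T ∈ upperBounds {S : L n d | ∃ X ∈ H, S.val = {X}} ↔ Refines H T.val := by
  constructor
  · intro h X hX
    have := L.le_iff_refines.1 (h (a := singL n d X (hH X hX).le) ⟨X, hX, rfl⟩)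
    exact this X (by simp [singL])
  · rintro h S ⟨X, hX, hS⟩
    rw [L.le_iff_refines, hS]
    intro Y hY
    rw [Finset.mem_singleton] at hY
    exact hY ▸ h X hX

/-- The meet of `S` with `{A}`. -/
noncomputable def meetSingle (d : ℕ) (S : Coll n) (A : Finset (Fin n)) : Coll n :=
  (S.image (fun Y => Y ∪ A)).filter (fun Y => Y.card ≤ d)

theorem mem_meetSingle {S : Coll n} {A Z : Finset (Fin n)} :
    Z ∈ meetSingle d S A ↔ ∃ Y ∈ S, (Y ∪ A).card ≤ d ∧ Y ∪ A = Z := by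
  simp only [meetSingle, Finset.mem_filter, Finset.mem_image]
  constructor
  · rintro ⟨⟨Y, hY, rfl⟩, h⟩
    exact ⟨Y, hY, h, rfl⟩
  · rintro ⟨Y, hY, h, rfl⟩
    exact ⟨⟨Y, hY, rfl⟩, h⟩

theorem codim_union_single (X A : Finset (Fin n)) :
    codim d (X ∪ A) = codim d X - ((A \ X).card : ℤ) := by
  have := Finset.card_sdiff_add_card A X
  rw [Finset.union_comm] at this
  simp only [codim]
  omega

theorem memL.meetSingle {S : Coll n} (hS : memL n d S) (A : Finset (Fin n)) :
    memL n d (meetSingle d S A) := by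
  constructor
  · intro T' hT' h2
    set F := S.filter (fun Y => Y ∪ A ∈ T') with hF
    have hcard : ∀ Z ∈ T', Z.card ≤ d := fun Z hZ => (Finset.mem_filter.1 (hT' hZ)).2
    have hinj : Set.InjOn (fun Y => Y ∪ A) (F : Set (Finset (Fin n))) := by
      intro Y hY Z hZ hYZ
      simp only [hF, Finset.mem_coe, Finset.mem_filter] at hY hZ hYZ
      exact hS.eq_of_subset hY.1 hZ.1 (hcard _ hY.2) Finset.subset_union_left
        (hYZ ▸ Finset.subset_union_left)
    have himg : F.image (fun Y => Y ∪ A) = T' := by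
      ext Z
      simp only [hF, Finset.mem_image, Finset.mem_filter]
      constructor
      · rintro ⟨Y, hY, rfl⟩
        exact hY.2
      · intro hZ
        obtain ⟨Y, hY, -, rfl⟩ := mem_meetSingle.1 (hT' hZ)
        exact ⟨Y, ⟨hY, hZ⟩, rfl⟩
    have hFcard : 2 ≤ F.card := by
      rw [← himg, Finset.card_image_of_injOn hinj] at h2
      exact h2
    have hD := hS.1 F (Finset.filter_subset _ _) hFcard
    have hrho : rho d T' = rho d F - ∑ Y ∈ F, ((A \ Y).card : ℤ) := by
      rw [← himg, rho, Finset.sum_image hinj, rho, ← Finset.sum_sub_distrib]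
      exact Finset.sum_congr rfl fun Y _ => codim_union_single Y A
    have hinf : T'.inf id = F.inf id ∪ A := by
      ext x
      simp only [← himg, Finset.mem_inf, Finset.mem_union, Finset.forall_mem_image, id]
      refine ⟨fun h => ?_, fun h Y hY => h.imp_left fun h => h Y hY⟩
      by_cases hx : x ∈ A
      · exact Or.inr hx
      · exact Or.inl fun Y hY => (h hY).resolve_right hx
    have hle : (A \ F.inf id).card ≤ ∑ Y ∈ F, (A \ Y).card := by
      refine le_trans (Finset.card_le_card ?_) (Finset.card_biUnion_le (s := F) (t := (A \ ·)))
      intro x hx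
      simp only [Finset.mem_sdiff, Finset.mem_inf, id, not_forall, Finset.mem_biUnion] at hx ⊢
      obtain ⟨hxA, Y, hY, hxY⟩ := hx
      exact ⟨Y, hY, hxA, hxY⟩
    have hle' : ((A \ F.inf id).card : ℤ) ≤ ∑ Y ∈ F, ((A \ Y).card : ℤ) := by
      exact_mod_cast hle
    simp only [Dd] at hD ⊢
    rw [hinf, hrho, codim_union_single]
    omega
  · intro X hX
    exact (Finset.mem_filter.1 hX).2

/-- A member of a collection may be replaced by a collection of sets containing it. -/
theorem memL.replace {T B : Coll n} (hT : memL n d T) (hB : memL n d B) {A : Finset (Fin n)}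
    (hA : A ∈ T) (hAB : ∀ X ∈ B, A ⊆ X) : memL n d (T.erase A ∪ B) := by
  constructor
  · intro U hU h2
    set P := U.filter (· ∉ B) with hP
    set Q := U.filter (· ∈ B) with hQ
    have hPQ : P ∪ Q = U := by
      rw [Finset.union_comm]
      exact Finset.filter_union_filter_not_eq _ _
    have hdisj : Disjoint P Q := (Finset.disjoint_filter_filter_not _ _ _).symm
    have hPT : P ⊆ T.erase A := by
      intro X hX
      simp only [hP, Finset.mem_filter] at hX
      exact (Finset.mem_union.1 (hU hX.1)).resolve_right hX.2
    have hQB : Q ⊆ B := fun X hX => (Finset.mem_filter.1 hX).2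
    rcases P.eq_empty_or_nonempty with h0 | ⟨X₀, hX₀⟩
    · rw [h0, Finset.empty_union] at hPQ
      exact hB.1 U (hPQ ▸ hQB) h2
    rcases Q.eq_empty_or_nonempty with h0 | hQne
    · rw [h0, Finset.union_empty] at hPQ
      exact hT.1 U (hPQ ▸ hPT.trans (Finset.erase_subset _ _)) h2
    have hAP : A ∉ P := fun h => by simpa using hPT h
    have hD := hT.1 (insert A P)
      (Finset.insert_subset hA (hPT.trans (Finset.erase_subset _ _)))
      (by rw [Finset.card_insert_of_notMem hAP]; have := Finset.card_pos.2 ⟨X₀, hX₀⟩; omega)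
    have hAQ : A ⊆ Q.inf id := Finset.le_inf fun X hX => hAB X (hQB hX)
    have hQle : rho d Q ≤ codim d (Q.inf id) := by
      refine ((hB.mono hQB).rho_le_codim ?_ fun X hX => ?_).1
      · obtain ⟨X, hX⟩ := hQne
        exact (Finset.card_le_card (Finset.inf_le (f := id) hX)).trans (hB.2 X (hQB hX))
      · exact Finset.inf_le (f := id) hX
    have hrho : rho d U = rho d P + rho d Q := by
      rw [← hPQ, rho, Finset.sum_union hdisj]
      rfl
    have hrho' : rho d (insert A P) = codim d A + rho d P := Finset.sum_insert hAP
    have hinf : U.inf id = P.inf id ∩ Q.inf id := by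
      rw [← hPQ, Finset.inf_union]
      rfl
    have hc := Finset.card_union_add_card_inter (P.inf id ∩ Q.inf id) A
    have hc1 : (P.inf id ∩ Q.inf id ∪ A).card ≤ (Q.inf id).card :=
      Finset.card_le_card (Finset.union_subset Finset.inter_subset_right hAQ)
    have hc2 : P.inf id ∩ Q.inf id ∩ A = A ∩ P.inf id := by
      rw [Finset.inter_assoc, Finset.inter_eq_right.2 hAQ, Finset.inter_comm]
    rw [hc2] at hc
    simp only [Dd, hrho', hrho, hinf, Finset.inf_insert, id, codim, Finset.inf_eq_inter]
      at hD hQle ⊢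
    omega
  · intro X hX
    rcases Finset.mem_union.1 hX with hX | hX
    · exact hT.2 X (Finset.mem_of_mem_erase hX)
    · exact hB.2 X hX

theorem isLUB_iff_spans {H : Coll n} (hH : ∀ X ∈ H, X.card = d) {T : L n d} :
    IsLUB {S : L n d | ∃ X ∈ H, S.val = {X}} T ↔
      Refines H T.val ∧ ∀ A ∈ T.val, Spans d (H.filter (A ⊆ ·)) A := by
  rw [IsLUB, IsLeast, mem_upperBounds_iff_refines hH]
  refine and_congr_right fun hHT => ⟨fun hT A hA S hS hHS => ?_, fun h S hS => ?_⟩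
  · have hU : memL n d (T.val.erase A ∪ meetSingle d S A) := by
      refine T.mem.replace (hS.meetSingle A) hA fun X hX => ?_
      obtain ⟨Y, -, -, rfl⟩ := mem_meetSingle.1 hX
      exact Finset.subset_union_right
    have hle := L.le_iff_refines.1 (hT (a := ⟨_, hU⟩) ((mem_upperBounds_iff_refines hH).2 ?_))
    · obtain ⟨Z, hZ, hZA⟩ := hle A hA
      rcases Finset.mem_union.1 hZ with hZ | hZ
      · rw [Finset.mem_erase] at hZ
        exact absurd (T.mem.eq_of_subset hZ.2 hA (T.mem.2 A hA) hZA subset_rfl) hZ.1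
      · obtain ⟨Y, hY, -, rfl⟩ := mem_meetSingle.1 hZ
        exact ⟨Y, hY, Finset.subset_union_left.trans hZA⟩
    · intro X hX
      by_cases hAX : A ⊆ X
      · obtain ⟨Y, hY, hYX⟩ := hHS X (by simp [hX, hAX])
        have hsub := Finset.union_subset hYX hAX
        refine ⟨Y ∪ A, Finset.mem_union_right _ (mem_meetSingle.2 ⟨Y, hY, ?_, rfl⟩), hsub⟩
        exact (Finset.card_le_card hsub).trans (hH X hX).le
      · obtain ⟨Y, hY, hYX⟩ := hHT X hX
        refine ⟨Y, Finset.mem_union_left _ (Finset.mem_erase.2 ⟨?_, hY⟩), hYX⟩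
        rintro rfl
        exact hAX hYX
  · rw [mem_upperBounds_iff_refines hH] at hS
    rw [L.le_iff_refines]
    exact fun A hA => h A hA S.val S.mem fun X hX => hS X (Finset.mem_filter.1 hX).1

/-- The action of a permutation on sets. -/
abbrev permSet (σ : Equiv.Perm (Fin n)) : Finset (Fin n) ≃ Finset (Fin n) := σ.finsetCongr

theorem permSet_subset_permSet (σ : Equiv.Perm (Fin n)) {X Y : Finset (Fin n)} :
    permSet σ X ⊆ permSet σ Y ↔ X ⊆ Y := by
  simp

theorem card_permSet (σ : Equiv.Perm (Fin n)) (X : Finset (Fin n)) :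
    (permSet σ X).card = X.card := by
  simp

theorem Dd_map_permSet (σ : Equiv.Perm (Fin n)) (T : Coll n) :
    Dd d (T.map (permSet σ).toEmbedding) = Dd d T := by
  have hinf : (T.map (permSet σ).toEmbedding).inf id = permSet σ (T.inf id) := by
    ext x
    rw [Finset.mem_inf, Finset.forall_mem_map]
    simp only [Finset.mem_inf, id, Equiv.finsetCongr_apply, Equiv.coe_toEmbedding,
      Finset.mem_map_equiv]
  simp only [Dd, rho, codim, hinf, card_permSet, Finset.sum_map, Equiv.coe_toEmbedding]

theorem memL.map_permSet {T : Coll n} (hT : memL n d T) (σ : Equiv.Perm (Fin n)) :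
    memL n d (T.map (permSet σ).toEmbedding) := by
  constructor
  · intro T' hT' h2
    obtain ⟨F, hF, rfl⟩ := Finset.subset_map_iff.1 hT'
    rw [Dd_map_permSet]
    exact hT.1 F hF (by simpa using h2)
  · intro X hX
    obtain ⟨Y, hY, rfl⟩ := Finset.mem_map.1 hX
    exact (card_permSet σ Y).trans_le (hT.2 Y hY)

theorem Spans.map_permSet {H : Coll n} {A : Finset (Fin n)} (h : Spans d H A)
    (σ : Equiv.Perm (Fin n)) : Spans d (H.map (permSet σ).toEmbedding) (permSet σ A) := by
  intro S hS hHS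
  obtain ⟨Z, hZ, hZA⟩ := h _ (hS.map_permSet σ.symm) fun X hX => by
    obtain ⟨Y, hY, hYX⟩ := hHS (permSet σ X) (Finset.mem_map_of_mem _ hX)
    refine ⟨permSet σ.symm Y, Finset.mem_map_of_mem _ hY, ?_⟩
    rw [← permSet_subset_permSet σ]
    simpa [Finset.map_map] using hYX
  obtain ⟨Y, hY, rfl⟩ := Finset.mem_map.1 hZ
  refine ⟨Y, hY, ?_⟩
  rw [← permSet_subset_permSet σ.symm]
  simpa [Finset.map_map] using hZA

theorem exists_permSet_eq {A B : Finset (Fin n)} (h : A.card = B.card) :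
    ∃ σ : Equiv.Perm (Fin n), permSet σ A = B := by
  refine ⟨(Finset.equivOfCardEq h).extendSubtype, ?_⟩
  refine Finset.eq_of_subset_of_card_le (fun x hx => ?_) (by simp [h])
  obtain ⟨a, ha, rfl⟩ := Finset.mem_map.1 hx
  exact Equiv.extendSubtype_mem _ a ha

theorem exists_equiv_of_map_eq {α β : Type*} {S T : Finset α} (f : α → β)
    (h : S.val.map f = T.val.map f) : ∃ e : S ≃ T, ∀ a, f (e a) = f a := by
  have hfib : ∀ c, Nonempty ({a : S // f a = c} ≃ {b : T // f b = c}) := by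
    intro c
    have hc := congrArg (Multiset.count c) h
    rw [Multiset.count_map, Multiset.count_map] at hc
    have hcard : ∀ U : Finset α, Fintype.card {a : U // f a = c} =
        (U.val.filter (fun a => c = f a)).card := by
      intro U
      change _ = (U.filter (fun a => c = f a)).card
      rw [Fintype.card_subtype, Finset.card_filter, Finset.card_filter]
      simp only [eq_comm (a := c)]
      exact Finset.sum_coe_sort U (fun a => if f a = c then 1 else 0)
    exact ⟨Fintype.equivOfCardEq (by rw [hcard, hcard, hc])⟩
  exact ⟨Equiv.ofFiberEquiv fun c => (hfib c).some, fun a =>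
    Equiv.ofFiberEquiv_map (f := fun a : S => f a) (g := fun b : T => f b) _ a⟩

/-- Move the members of `H` above `A` by the permutation `σ A`, for each `A ∈ T`. -/
noncomputable def transport (T : Coll n) (σ : Finset (Fin n) → Equiv.Perm (Fin n))
    (H : Coll n) : Coll n :=
  T.biUnion fun A => (H.filter (A ⊆ ·)).map (permSet (σ A)).toEmbedding

theorem filter_transport {T T' : Coll n} (hT' : memL n d T')
    {σ : Finset (Fin n) → Equiv.Perm (Fin n)} (hσT : ∀ A ∈ T, permSet (σ A) A ∈ T')
    (hσ : Set.InjOn (fun A => permSet (σ A) A) (T : Set (Finset (Fin n))))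
    {H : Coll n} (hH : ∀ X ∈ H, X.card = d) {A : Finset (Fin n)} (hA : A ∈ T) :
    (transport T σ H).filter (permSet (σ A) A ⊆ ·) =
      (H.filter (A ⊆ ·)).map (permSet (σ A)).toEmbedding := by
  ext Z
  simp only [transport, Finset.mem_filter, Finset.mem_biUnion, Finset.mem_map,
    Equiv.coe_toEmbedding]
  constructor
  · rintro ⟨⟨B, hB, X, ⟨hX, hBX⟩, rfl⟩, hZ⟩
    have : A = B := hσ hA hB <| hT'.eq_of_subset (hσT A hA) (hσT B hB)
      ((card_permSet _ X).trans (hH X hX)).le hZ ((permSet_subset_permSet _).2 hBX)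
    subst this
    exact ⟨X, ⟨hX, hBX⟩, rfl⟩
  · rintro ⟨X, hX, rfl⟩
    exact ⟨⟨A, hA, X, hX, rfl⟩, (permSet_subset_permSet _).2 hX.2⟩

theorem Refines.biUnion_filter {H T : Coll n} (h : Refines H T) :
    (T.biUnion fun A => H.filter (A ⊆ ·)) = H := by
  ext X
  simp only [Finset.mem_biUnion, Finset.mem_filter]
  constructor
  · rintro ⟨A, -, hX, -⟩
    exact hX
  · intro hX
    obtain ⟨A, hA, hAX⟩ := h X hX
    exact ⟨A, hA, hX, hAX⟩

theorem Refines.card_eq_sum {H T : Coll n} (hT : memL n d T) (hH : ∀ X ∈ H, X.card = d)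
    (h : Refines H T) : H.card = ∑ A ∈ T, (H.filter (A ⊆ ·)).card := by
  conv_lhs => rw [← h.biUnion_filter]
  refine Finset.card_biUnion fun A hA B hB hAB => Finset.disjoint_left.2 fun X hXA hXB => hAB ?_
  rw [Finset.mem_filter] at hXA hXB
  exact hT.eq_of_subset hA hB (hH X hXA.1).le hXA.2 hXB.2

theorem kappa_le_of_typeOf_eq (T T' : L n d) (htype : typeOf d T = typeOf d T') (m : ℕ) :
    kappa n d m T ≤ kappa n d m T' := by
  obtain ⟨e, he⟩ := exists_equiv_of_map_eq _ htype
  have hex : ∀ A : T.val, ∃ σ : Equiv.Perm (Fin n), permSet σ A = (e A : Finset (Fin n)) := by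
    intro A
    refine exists_permSet_eq ?_
    have h1 := he A
    have h2 := T.mem.2 A A.2
    have h3 := T'.mem.2 _ (e A).2
    omega
  choose σ₀ hσ₀ using hex
  obtain ⟨σ, hσ⟩ : ∃ σ : Finset (Fin n) → Equiv.Perm (Fin n),
      ∀ A : T.val, permSet (σ A) A = (e A : Finset (Fin n)) :=
    ⟨fun A => if h : A ∈ T.val then σ₀ ⟨A, h⟩ else 1, fun A => by simpa using hσ₀ A⟩
  have hσT : ∀ A ∈ T.val, permSet (σ A) A ∈ T'.val := fun A hA => by
    rw [hσ ⟨A, hA⟩]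
    exact (e ⟨A, hA⟩).2
  have hσinj : Set.InjOn (fun A => permSet (σ A) A) (T.val : Set (Finset (Fin n))) := by
    intro A hA B hB hAB
    have hAB' : permSet (σ A) A = permSet (σ B) B := hAB
    rw [hσ ⟨A, hA⟩, hσ ⟨B, hB⟩] at hAB'
    simpa using e.injective (Subtype.ext hAB')
  have hσsurj : ∀ B ∈ T'.val, ∃ A ∈ T.val, permSet (σ A) A = B := fun B hB =>
    ⟨e.symm ⟨B, hB⟩, (e.symm ⟨B, hB⟩).2, by rw [hσ]; simp⟩
  have himg : T.val.image (fun A => permSet (σ A) A) = T'.val := by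
    ext B
    rw [Finset.mem_image]
    constructor
    · rintro ⟨A, hA, rfl⟩
      exact hσT A hA
    · exact hσsurj B
  refine Finset.card_le_card_of_injOn (transport T.val σ) ?_ ?_
  · intro H hH
    simp only [Finset.mem_coe, Finset.mem_filter, Finset.mem_univ, true_and] at hH ⊢
    obtain ⟨hm, hHd, hlub⟩ := hH
    obtain ⟨href, hspan⟩ := (isLUB_iff_spans hHd).1 hlub
    have hd' : ∀ X ∈ transport T.val σ H, X.card = d := by
      intro X hX
      simp only [transport, Finset.mem_biUnion, Finset.mem_map, Finset.mem_filter] at hX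
      obtain ⟨A, -, Y, hY, rfl⟩ := hX
      exact (card_permSet _ Y).trans (hHd Y hY.1)
    have href' : Refines (transport T.val σ H) T'.val := by
      intro X hX
      simp only [transport, Finset.mem_biUnion, Finset.mem_map, Finset.mem_filter] at hX
      obtain ⟨A, hA, Y, hY, rfl⟩ := hX
      exact ⟨_, hσT A hA, (permSet_subset_permSet _).2 hY.2⟩
    refine ⟨?_, hd', (isLUB_iff_spans hd').2 ⟨href', fun B hB => ?_⟩⟩
    · rw [← hm, href'.card_eq_sum T'.mem hd', href.card_eq_sum T.mem hHd, ← himg,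
        Finset.sum_image hσinj]
      refine Finset.sum_congr rfl fun A hA => ?_
      rw [filter_transport T'.mem hσT hσinj hHd hA, Finset.card_map]
    · obtain ⟨A, hA, rfl⟩ := hσsurj B hB
      rw [filter_transport T'.mem hσT hσinj hHd hA]
      exact (hspan A hA).map_permSet (σ A)
  · intro H hH K hK hHK
    simp only [Finset.mem_coe, Finset.mem_filter, Finset.mem_univ, true_and] at hH hK
    obtain ⟨-, hHd, hHlub⟩ := hH
    obtain ⟨-, hKd, hKlub⟩ := hK
    rw [← ((isLUB_iff_spans hHd).1 hHlub).1.biUnion_filter,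
      ← ((isLUB_iff_spans hKd).1 hKlub).1.biUnion_filter]
    refine Finset.biUnion_congr rfl fun A hA => ?_
    refine Finset.map_injective (permSet (σ A)).toEmbedding ?_
    rw [← filter_transport T'.mem hσT hσinj hHd hA, hHK,
      filter_transport T'.mem hσT hσinj hKd hA]

end

/-- If `T, T' ∈ L(n,d)` have the same type `γ_d(T) = γ_d(T')`,
then `κ_{n,d}(m, T) = κ_{n,d}(m, T')` for every `m ≥ 1`. -/
theorem kappa_depends_only_on_type (n d : ℕ) (hd : 1 ≤ d) (hnd : d < n)
    (T T' : L n d) (htype : typeOf d T = typeOf d T') (m : ℕ) (hm : 1 ≤ m) :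
    kappa n d m T = kappa n d m T' := by
  exact (kappa_le_of_typeOf_eq T T' htype m).antisymm (kappa_le_of_typeOf_eq T' T htype.symm m)
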